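/- Fix a natural number n ≥ 1 and a real number p with 0 < p < 1. The expected number of replicas replying to the client is antitone in the fault-tolerance parameter: for all natural numbers f₁, f₂ with 0 ≤ f₁ ≤ f₂ ≤ ⌊(n−1)/3⌋, E(n, f₁, p) ≥ E(n, f₂, p). -/

import Mathlib

open Finset

/-- `binomTail p k n` is the probability that a `Binomial(n, p)` random variable is
at least `k`: `∑_{j=k}^{n} C(n,j) p^j (1-p)^(n-j)`. In the PBFT model it is the
probability that a node receives at least `k` of `n` messages when each message is
delivered independently with probability `p`. -/
noncomputable def binomTail (p : ℝ) (k n : ℕ) : ℝ :=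
  ∑ j ∈ Finset.Icc k n, (n.choose j : ℝ) * p ^ j * (1 - p) ^ (n - j)

/-- The joint probability that, in PBFT with `n` replicas tolerating `f` faults and
per-message delivery probability `p`, `m` of the `n-1` backups receive the
PRE-PREPARE, `k` of the `m+1` participating nodes accept the PREPARE phase (each
needing at least `2f` of `m` distinct PREPARE messages), `j` of the `k` nodes accept
the COMMIT phase (each needing at least `2f` of `k-1` distinct COMMIT messages), and
`s` of the `j` REPLY messages reach the client. -/
noncomputable def jointProb (n f : ℕ) (p : ℝ) (m k j s : ℕ) : ℝ :=
  (j.choose s : ℝ) * p ^ s * (1 - p) ^ (j - s) *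
    ((k.choose j : ℝ) * binomTail p (2 * f) (k - 1) ^ j *
      (1 - binomTail p (2 * f) (k - 1)) ^ (k - j)) *
    (((m + 1).choose k : ℝ) * binomTail p (2 * f) m ^ k *
      (1 - binomTail p (2 * f) m) ^ (m + 1 - k)) *
    ((n - 1).choose m : ℝ) * p ^ m * (1 - p) ^ (n - 1 - m)

/-- `expectedReplies n f p` is the expected number of replicas replying to the
client, `E[S, J ≥ 2f+1, K ≥ 2f+1, M ≥ 2f+1]`: the sum over `m = 2f, …, n-1`,
`k = 2f+1, …, m+1`, `j = 2f+1, …, k`, `s = 0, …, j` of `s` times the joint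
probability of these phase outcomes. -/
noncomputable def expectedReplies (n f : ℕ) (p : ℝ) : ℝ :=
  ∑ m ∈ Finset.Icc (2 * f) (n - 1), ∑ k ∈ Finset.Icc (2 * f + 1) (m + 1),
    ∑ j ∈ Finset.Icc (2 * f + 1) k, ∑ s ∈ Finset.range (j + 1),
      (s : ℝ) * jointProb n f p m k j s

noncomputable def bA (q : ℝ) : ℕ → (ℕ → ℝ) → ℝ
  | 0, g => g 0
  | N + 1, g => (1 - q) * bA q N g + q * bA q N (fun i => g (i + 1))

theorem bA_eq (q : ℝ) (N : ℕ) (g : ℕ → ℝ) :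
    bA q N g = ∑ i ∈ range (N + 1), (N.choose i : ℝ) * q ^ i * (1 - q) ^ (N - i) * g i := by
  induction N generalizing g with
  | zero => simp [bA]
  | succ N ih =>
    have h2 : (1 - q) * ∑ i ∈ range (N + 1), (N.choose i : ℝ) * q ^ i * (1 - q) ^ (N - i) * g i
        = ∑ i ∈ range (N + 2), (N.choose i : ℝ) * q ^ i * (1 - q) ^ (N + 1 - i) * g i := by
      rw [sum_range_succ _ (N + 1), mul_sum]
      simp only [Nat.choose_succ_self, Nat.cast_zero, zero_mul, add_zero]
      refine sum_congr rfl fun i hi => ?_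
      have : i ≤ N := by simpa [Nat.lt_succ_iff] using hi
      rw [Nat.succ_sub this, pow_succ]; ring
    rw [bA, ih, ih, h2, sum_range_succ' _ (N + 1), sum_range_succ' _ (N + 1), mul_sum,
      add_right_comm, ← sum_add_distrib]
    congr 1
    · refine sum_congr rfl fun i hi => ?_
      rw [Nat.choose_succ_succ, Nat.add_sub_add_right]
      push_cast
      ring
    · simp

theorem bA_mono_g {q : ℝ} (h0 : 0 ≤ q) (h1 : q ≤ 1) (N : ℕ) {g g' : ℕ → ℝ}
    (h : ∀ i, g i ≤ g' i) : bA q N g ≤ bA q N g' := by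
  induction N generalizing g g' with
  | zero => exact h 0
  | succ N ih =>
    have a := mul_le_mul_of_nonneg_left (ih h) (sub_nonneg.2 h1)
    have b := mul_le_mul_of_nonneg_left
      (ih (g := fun i => g (i + 1)) (g' := fun i => g' (i + 1)) (fun i => h (i + 1))) h0
    simp only [bA]; linarith

theorem bA_const (q : ℝ) (N : ℕ) (c : ℝ) : bA q N (fun _ => c) = c := by
  induction N with
  | zero => rfl
  | succ N ih => simp only [bA, ih]; ring

theorem bA_nonneg {q : ℝ} (h0 : 0 ≤ q) (h1 : q ≤ 1) (N : ℕ) {g : ℕ → ℝ}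
    (h : ∀ i, 0 ≤ g i) : 0 ≤ bA q N g := by
  simpa [bA_const] using bA_mono_g h0 h1 N (g := fun _ => 0) h

theorem bA_mono_q {q q' : ℝ} (h0 : 0 ≤ q) (hq : q ≤ q') (h1 : q' ≤ 1) (N : ℕ) {g : ℕ → ℝ}
    (h : Monotone g) : bA q N g ≤ bA q' N g := by
  induction N generalizing g with
  | zero => exact le_rfl
  | succ N ih =>
    have hs : Monotone (fun i => g (i + 1)) := fun a b hab => h (by omega)
    have a := ih h
    have b := ih hs
    have c := bA_mono_g (h0.trans hq) h1 N (g := g) (g' := fun i => g (i + 1))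
      (fun i => h (by omega))
    simp only [bA]
    nlinarith [mul_nonneg (sub_nonneg.2 hq) (sub_nonneg.2 c),
      mul_nonneg h0 (sub_nonneg.2 b), mul_nonneg (sub_nonneg.2 (hq.trans h1)) (sub_nonneg.2 a)]

theorem bA_mono_N {q : ℝ} (h0 : 0 ≤ q) (h1 : q ≤ 1) {g : ℕ → ℝ}
    (h : Monotone g) : Monotone (fun N => bA q N g) := by
  refine monotone_nat_of_le_succ fun N => ?_
  have c := bA_mono_g h0 h1 N (g := g) (g' := fun i => g (i + 1)) (fun i => h (by omega))
  simp only [bA]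
  nlinarith [mul_nonneg h0 (sub_nonneg.2 c)]

noncomputable def truncF (a : ℕ) (h : ℕ → ℝ) (k : ℕ) : ℝ := if a ≤ k then h k else 0

theorem truncF_nonneg (a : ℕ) {h : ℕ → ℝ} (h0 : ∀ i, 0 ≤ h i) (k : ℕ) : 0 ≤ truncF a h k := by
  unfold truncF; split_ifs <;> simp [h0]

theorem truncF_mono (a : ℕ) {h : ℕ → ℝ} (h0 : ∀ i, 0 ≤ h i) (hm : Monotone h) :
    Monotone (truncF a h) := by
  intro x y hxy
  unfold truncF
  split_ifs
  · exact hm hxy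
  · omega
  · exact h0 y
  · exact le_rfl

theorem truncF_anti {a b : ℕ} (hab : a ≤ b) {h h' : ℕ → ℝ} (h0 : ∀ i, 0 ≤ h i)
    (hh : ∀ i, h' i ≤ h i) (k : ℕ) : truncF b h' k ≤ truncF a h k := by
  unfold truncF
  split_ifs
  · exact hh k
  · omega
  · exact h0 k
  · exact le_rfl

theorem sum_Icc_eq (q : ℝ) (a N : ℕ) (h : ℕ → ℝ) :
    ∑ i ∈ Icc a N, (N.choose i : ℝ) * q ^ i * (1 - q) ^ (N - i) * h i = bA q N (truncF a h) := by
  rw [bA_eq]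
  simp only [truncF, mul_ite, mul_zero]
  rw [← sum_filter]
  refine sum_congr ?_ fun _ _ => rfl
  ext i; simp; omega

theorem binomTail_eq (p : ℝ) (k n : ℕ) : binomTail p k n = bA p n (truncF k fun _ => 1) := by
  rw [← sum_Icc_eq]; simp [binomTail]

section
variable {p : ℝ}

theorem bT_nonneg (hp0 : 0 ≤ p) (hp1 : p ≤ 1) (k n : ℕ) : 0 ≤ binomTail p k n := by
  rw [binomTail_eq]
  exact bA_nonneg hp0 hp1 n (truncF_nonneg k fun _ => zero_le_one)

theorem bT_le_one (hp0 : 0 ≤ p) (hp1 : p ≤ 1) (k n : ℕ) : binomTail p k n ≤ 1 := by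
  rw [binomTail_eq]
  refine (bA_mono_g hp0 hp1 n (g' := fun _ => 1) fun i => ?_).trans (bA_const p n 1).le
  unfold truncF; split_ifs <;> simp

theorem bT_anti (hp0 : 0 ≤ p) (hp1 : p ≤ 1) {k l : ℕ} (h : k ≤ l) (n : ℕ) :
    binomTail p l n ≤ binomTail p k n := by
  simp only [binomTail_eq]
  exact bA_mono_g hp0 hp1 n (truncF_anti h (fun _ => zero_le_one) fun _ => le_rfl)

theorem bT_mono (hp0 : 0 ≤ p) (hp1 : p ≤ 1) (k : ℕ) : Monotone (binomTail p k) := by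
  intro m n h
  simp only [binomTail_eq]
  exact bA_mono_N hp0 hp1 (truncF_mono k (fun _ => zero_le_one) monotone_const) h

noncomputable def repl (p : ℝ) (j : ℕ) : ℝ := bA p j (fun s => (s : ℝ))

theorem repl_nonneg (hp0 : 0 ≤ p) (hp1 : p ≤ 1) (j : ℕ) : 0 ≤ repl p j :=
  bA_nonneg hp0 hp1 j fun s => Nat.cast_nonneg s

theorem repl_mono (hp0 : 0 ≤ p) (hp1 : p ≤ 1) : Monotone (repl p) :=
  bA_mono_N hp0 hp1 Nat.mono_cast

noncomputable def commE (p : ℝ) (f k : ℕ) : ℝ :=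
  bA (binomTail p (2 * f) (k - 1)) k (truncF (2 * f + 1) (repl p))

theorem commE_nonneg (hp0 : 0 ≤ p) (hp1 : p ≤ 1) (f k : ℕ) : 0 ≤ commE p f k :=
  bA_nonneg (bT_nonneg hp0 hp1 _ _) (bT_le_one hp0 hp1 _ _) k
    (truncF_nonneg _ (repl_nonneg hp0 hp1))

theorem commE_mono (hp0 : 0 ≤ p) (hp1 : p ≤ 1) (f : ℕ) : Monotone (commE p f) := by
  intro a b hab
  have hm := truncF_mono (2 * f + 1) (repl_nonneg hp0 hp1) (repl_mono hp0 hp1)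
  exact (bA_mono_q (bT_nonneg hp0 hp1 _ _) (bT_mono hp0 hp1 _ (Nat.sub_le_sub_right hab 1))
    (bT_le_one hp0 hp1 _ _) a hm).trans
    (bA_mono_N (bT_nonneg hp0 hp1 _ _) (bT_le_one hp0 hp1 _ _) hm hab)

theorem commE_anti (hp0 : 0 ≤ p) (hp1 : p ≤ 1) {f g : ℕ} (h : f ≤ g) (k : ℕ) :
    commE p g k ≤ commE p f k := by
  have hm := truncF_mono (2 * f + 1) (repl_nonneg hp0 hp1) (repl_mono hp0 hp1)
  exact (bA_mono_g (bT_nonneg hp0 hp1 _ _) (bT_le_one hp0 hp1 _ _) k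
    (truncF_anti (by omega) (repl_nonneg hp0 hp1) fun _ => le_rfl)).trans
    (bA_mono_q (bT_nonneg hp0 hp1 _ _) (bT_anti hp0 hp1 (by omega) _)
      (bT_le_one hp0 hp1 _ _) k hm)

noncomputable def prep (p : ℝ) (f m : ℕ) : ℝ :=
  bA (binomTail p (2 * f) m) (m + 1) (truncF (2 * f + 1) (commE p f))

theorem prep_nonneg (hp0 : 0 ≤ p) (hp1 : p ≤ 1) (f k : ℕ) : 0 ≤ prep p f k :=
  bA_nonneg (bT_nonneg hp0 hp1 _ _) (bT_le_one hp0 hp1 _ _) _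
    (truncF_nonneg _ (commE_nonneg hp0 hp1 f))

theorem prep_anti (hp0 : 0 ≤ p) (hp1 : p ≤ 1) {f g : ℕ} (h : f ≤ g) (m : ℕ) :
    prep p g m ≤ prep p f m := by
  have hm := truncF_mono (2 * f + 1) (commE_nonneg hp0 hp1 f) (commE_mono hp0 hp1 f)
  exact (bA_mono_g (bT_nonneg hp0 hp1 _ _) (bT_le_one hp0 hp1 _ _) _
    (truncF_anti (by omega) (commE_nonneg hp0 hp1 f) (commE_anti hp0 hp1 h))).trans
    (bA_mono_q (bT_nonneg hp0 hp1 _ _) (bT_anti hp0 hp1 (by omega) _)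
      (bT_le_one hp0 hp1 _ _) _ hm)

end

theorem expectedReplies_eq (n f : ℕ) (p : ℝ) :
    expectedReplies n f p = ∑ m ∈ Icc (2 * f) (n - 1),
      ((n - 1).choose m : ℝ) * p ^ m * (1 - p) ^ (n - 1 - m) * prep p f m := by
  unfold expectedReplies
  refine sum_congr rfl fun m _ => ?_
  rw [prep, ← sum_Icc_eq, mul_sum]
  refine sum_congr rfl fun k _ => ?_
  rw [commE, ← sum_Icc_eq, mul_sum, mul_sum]
  refine sum_congr rfl fun j _ => ?_
  rw [repl, bA_eq, mul_sum, mul_sum, mul_sum]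
  refine sum_congr rfl fun s _ => ?_
  unfold jointProb
  ring

/-- **Antitonicity in the fault-tolerance parameter.** For fixed `n ≥ 1` and
`0 < p < 1`, the expected number of replicas replying to the client is antitone in
`f`: for `0 ≤ f₁ ≤ f₂ ≤ ⌊(n-1)/3⌋` we have `E(n, f₁, p) ≥ E(n, f₂, p)`. -/
theorem expectedReplies_anti_in_f (n : ℕ) (hn : 1 ≤ n) (p : ℝ) (hp0 : 0 < p)
    (hp1 : p < 1) (f₁ f₂ : ℕ) (hle : f₁ ≤ f₂) (hf₂ : f₂ ≤ (n - 1) / 3) :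
    expectedReplies n f₁ p ≥ expectedReplies n f₂ p := by
  have h0 := hp0.le
  have h1 := hp1.le
  have h2 : 0 ≤ 1 - p := sub_nonneg.2 h1
  rw [expectedReplies_eq, expectedReplies_eq]
  refine (sum_le_sum fun m _ => mul_le_mul_of_nonneg_left (prep_anti h0 h1 hle m)
    (by positivity)).trans ?_
  refine sum_le_sum_of_subset_of_nonneg (Icc_subset_Icc_left (by omega)) fun m _ _ => ?_
  have := prep_nonneg h0 h1 f₁ m
  positivity
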